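/- (Proposition 3(ii).) Suppose q₀ ∈ (0,1), χ ∈ (0,1) and χ > max(χ*(q₀), 0). Then sup{v*_χ(q₀; p) : p ∈ P̄ ∪ P²} = ((l₂ − l₁) − χ·(c₂ − c₁))·q₀ + (l₁ − c₁) − (1 − χ)·(c₂ − c₁), and this supremum is attained at the price list p* = (l₁, l₁ + q₀·(l₂ − l₁)/(1 − χ + χ·q₀)) and at no other element of P̄ ∪ P². -/

import Mathlib

open Set Filter
open scoped Classical

noncomputable section

/-- The cutoff posterior q̄(p). -/
def qBar (l₁ l₂ p₁ p₂ : ℝ) : ℝ :=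
  if l₂ - (l₂ - l₁) / l₁ * p₁ ≤ p₂ then (p₂ - l₁) / (l₂ - l₁) else (p₂ - p₁) / l₂

/-- The slope λ(p). -/
def lamP (c₁ c₂ l₁ l₂ p₁ p₂ : ℝ) : ℝ :=
  ((p₂ - c₂) - (p₁ - c₁)) / qBar l₁ l₂ p₁ p₂

/-- The credibility threshold χ̲(q₀; p). -/
def chiLo (l₁ l₂ p₁ p₂ q₀ : ℝ) : ℝ :=
  (qBar l₁ l₂ p₁ p₂ - q₀) / (qBar l₁ l₂ p₁ p₂ * (1 - q₀))

/-- The prior threshold q̲(χ; p). -/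
def qLo (l₁ l₂ p₁ p₂ χ : ℝ) : ℝ :=
  qBar l₁ l₂ p₁ p₂ * (1 - χ) / (1 - χ * qBar l₁ l₂ p₁ p₂)

/-- p = (p₁, p₂) is a price list. -/
def IsPriceList (c₁ c₂ l₁ l₂ p₁ p₂ : ℝ) : Prop :=
  c₁ ≤ p₁ ∧ p₁ ≤ l₁ ∧ c₂ ≤ p₂ ∧ p₂ ≤ l₂ ∧ p₁ ≤ p₂

/-- The expert's p-equilibrium value v*_χ(q₀; p) for p ∈ P̄ ∪ P². -/
def vStar (c₁ c₂ l₁ l₂ χ q₀ p₁ p₂ : ℝ) : ℝ :=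
  if qBar l₁ l₂ p₁ p₂ < q₀ then p₂ - c₂
  else if qLo l₁ l₂ p₁ p₂ χ ≤ q₀ then lamP c₁ c₂ l₁ l₂ p₁ p₂ * q₀ + (p₁ - c₁)
  else p₁ - c₁

/-- The credibility threshold χ*(q₀). -/
def chiStarF (c₁ c₂ l₁ l₂ q₀ : ℝ) : ℝ :=
  ((c₂ - c₁) - q₀ * (l₂ - l₁)) / ((1 - q₀) * (c₂ - c₁))

end

/-- The high price never exceeds `l₁ + (l₂ - l₁) q̄`. -/
lemma le_add_mul_qBar {l₁ l₂ : ℝ} (hl₁ : 0 < l₁) (hl : l₁ < l₂) (p₁ p₂ : ℝ) :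
    p₂ ≤ l₁ + (l₂ - l₁) * qBar l₁ l₂ p₁ p₂ := by
  have hD : 0 < l₂ - l₁ := sub_pos.2 hl
  have hl₂ : 0 < l₂ := hl₁.trans hl
  unfold qBar
  split_ifs with h
  · rw [mul_div_cancel₀ _ hD.ne']
    linarith
  · push Not at h
    have h' : p₂ * l₁ < l₂ * l₁ - (l₂ - l₁) * p₁ := by
      have := mul_lt_mul_of_pos_right h hl₁
      have e : (l₂ - (l₂ - l₁) / l₁ * p₁) * l₁ = l₂ * l₁ - (l₂ - l₁) * p₁ := by
        field_simp
      linarith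
    have e : l₁ + (l₂ - l₁) * ((p₂ - p₁) / l₂) = (l₁ * l₂ + (l₂ - l₁) * (p₂ - p₁)) / l₂ := by
      field_simp
    rw [e, le_div_iff₀ hl₂]
    nlinarith

lemma qBar_le_one {l₁ l₂ p₁ p₂ : ℝ} (hl₁ : 0 < l₁) (hl : l₁ < l₂) (hp₁ : 0 ≤ p₁)
    (hp₂ : p₂ ≤ l₂) : qBar l₁ l₂ p₁ p₂ ≤ 1 := by
  unfold qBar
  split_ifs
  · rw [div_le_one (by linarith)]
    linarith
  · rw [div_le_one (by linarith)]
    linarith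

lemma qBar_self_left {l₁ l₂ p₂ : ℝ} (hl₁ : l₁ ≠ 0) (h : l₁ ≤ p₂) :
    qBar l₁ l₂ l₁ p₂ = (p₂ - l₁) / (l₂ - l₁) := by
  rw [qBar, if_pos]
  rw [div_mul_cancel₀ _ hl₁]
  linarith

lemma qLo_le_iff {l₁ l₂ p₁ p₂ χ q₀ : ℝ} (h : χ * qBar l₁ l₂ p₁ p₂ < 1) :
    qLo l₁ l₂ p₁ p₂ χ ≤ q₀ ↔ qBar l₁ l₂ p₁ p₂ * (1 - χ + χ * q₀) ≤ q₀ := by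
  rw [qLo, div_le_iff₀ (by linarith)]
  constructor <;> intro h <;> linarith

/-- The threshold condition on `χ`, cleared of denominators. -/
lemma chiStarF_lt_iff {c₁ c₂ l₁ l₂ q₀ χ : ℝ} (hc : c₁ < c₂) (hq₀ : q₀ < 1) :
    chiStarF c₁ c₂ l₁ l₂ q₀ < χ ↔ (c₂ - c₁) * (1 - χ + χ * q₀) < q₀ * (l₂ - l₁) := by
  rw [chiStarF, div_lt_iff₀ (mul_pos (by linarith) (by linarith))]
  constructor <;> intro h <;> linarith

/-- Every admissible price list yields strictly less than the optimal value, except the optimal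
one. -/
lemma vStar_lt_or_eq {c₁ c₂ l₁ l₂ q₀ χ p₁ p₂ : ℝ} (hc₁ : 0 ≤ c₁) (hc : c₁ < c₂) (h₁ : c₁ < l₁)
    (hl : l₁ < l₂) (hq₀ : q₀ ∈ Set.Ioo (0 : ℝ) 1) (hχ : χ ∈ Set.Ioo (0 : ℝ) 1)
    (hχ' : chiStarF c₁ c₂ l₁ l₂ q₀ < χ) (hp : IsPriceList c₁ c₂ l₁ l₂ p₁ p₂) :
    vStar c₁ c₂ l₁ l₂ χ q₀ p₁ p₂
      < ((l₂ - l₁) - χ * (c₂ - c₁)) * q₀ + (l₁ - c₁) - (1 - χ) * (c₂ - c₁) ∨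
    p₁ = l₁ ∧ p₂ = l₁ + q₀ * (l₂ - l₁) / (1 - χ + χ * q₀) := by
  obtain ⟨hq0, hq1⟩ := hq₀
  obtain ⟨hχ0, hχ1⟩ := hχ
  obtain ⟨ha, hb, -, hd, -⟩ := hp
  rw [chiStarF_lt_iff hc hq1] at hχ'
  have hD : 0 < l₂ - l₁ := sub_pos.2 hl
  have hl₁ : 0 < l₁ := hc₁.trans_lt h₁
  have hle := le_add_mul_qBar hl₁ hl p₁ p₂
  have hone := qBar_le_one hl₁ hl (hc₁.trans ha) hd
  have hcd : 0 < c₂ - c₁ := sub_pos.2 hc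
  have hk : 0 < 1 - χ + χ * q₀ := by nlinarith
  have hk1 : 1 - χ + χ * q₀ < 1 := by nlinarith
  rw [vStar]
  split_ifs with hA hB
  · left
    have := mul_lt_mul_of_pos_left hA hD
    have := mul_lt_mul_of_pos_left hk1 hcd
    linarith
  · push Not at hA
    have hq : 0 < qBar l₁ l₂ p₁ p₂ := hq0.trans_le hA
    rw [qLo_le_iff (by nlinarith)] at hB
    rw [lamP]
    generalize qBar l₁ l₂ p₁ p₂ = q at *
    obtain ⟨r, rfl⟩ : ∃ r, q₀ = r * q := ⟨q₀ / q, by field_simp⟩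
    have hr : 0 < r := pos_of_mul_pos_left hq0 hq.le
    have hr1 : r ≤ 1 := le_of_mul_le_mul_right (by linarith) hq
    have hkr : 1 - χ + χ * (r * q) ≤ r := le_of_mul_le_mul_right (by linarith) hq
    have e : (p₂ - c₂ - (p₁ - c₁)) / q * (r * q) = (p₂ - c₂ - (p₁ - c₁)) * r := by
      field_simp
    rw [e]
    have s₁ : 0 ≤ (l₁ + (l₂ - l₁) * q - p₂) * r := mul_nonneg (by linarith) hr.le
    have s₂ : 0 ≤ (l₁ - p₁) * (1 - r) := mul_nonneg (by linarith) (by linarith)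
    have s₃ : 0 ≤ (c₂ - c₁) * (r - (1 - χ + χ * (r * q))) := mul_nonneg hcd.le (by linarith)
    rw [or_iff_not_imp_left]
    intro hge
    push Not at hge
    have t₃ : (c₂ - c₁) * (r - (1 - χ + χ * (r * q))) = 0 := by linarith
    have t₂ : (l₁ - p₁) * (1 - r) = 0 := by linarith
    have t₁ : (l₁ + (l₂ - l₁) * q - p₂) * r = 0 := by linarith
    have u₃ : 1 - χ + χ * (r * q) = r := by
      linarith [(mul_eq_zero.1 t₃).resolve_left hcd.ne']
    have u₂ : l₁ - p₁ = 0 := (mul_eq_zero.1 t₂).resolve_right (by linarith)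
    have u₁ : l₁ + (l₂ - l₁) * q - p₂ = 0 := (mul_eq_zero.1 t₁).resolve_right hr.ne'
    refine ⟨by linarith, ?_⟩
    rw [u₃, mul_assoc, mul_div_cancel_left₀ _ hr.ne']
    linarith
  · left
    linarith

/-- Proposition 3(ii): when χ > max(χ*(q₀), 0), the supremum of
v*_χ(q₀; ·) over P̄ ∪ P² equals ((l₂ − l₁) − χ(c₂ − c₁))q₀ + (l₁ − c₁) − (1 − χ)(c₂ − c₁),
it is attained at p* = (l₁, l₁ + q₀(l₂ − l₁)/(1 − χ + χq₀)), and at no other element of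
P̄ ∪ P². -/
theorem prop3_part2
    (c₁ c₂ l₁ l₂ : ℝ) (hc₁ : 0 ≤ c₁) (hc : c₁ < c₂) (h₁ : c₁ < l₁) (h₂ : c₂ < l₂)
    (hs : l₁ - c₁ < l₂ - c₂)
    (q₀ χ : ℝ) (hq₀ : q₀ ∈ Set.Ioo (0:ℝ) 1) (hχ : χ ∈ Set.Ioo (0:ℝ) 1)
    (hχ' : max (chiStarF c₁ c₂ l₁ l₂ q₀) 0 < χ) :
    IsGreatest {e | ∃ p₁ p₂ : ℝ, IsPriceList c₁ c₂ l₁ l₂ p₁ p₂ ∧ p₁ - c₁ ≤ p₂ - c₂ ∧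
        e = vStar c₁ c₂ l₁ l₂ χ q₀ p₁ p₂}
      (((l₂ - l₁) - χ * (c₂ - c₁)) * q₀ + (l₁ - c₁) - (1 - χ) * (c₂ - c₁)) ∧
    vStar c₁ c₂ l₁ l₂ χ q₀ l₁ (l₁ + q₀ * (l₂ - l₁) / (1 - χ + χ * q₀))
      = ((l₂ - l₁) - χ * (c₂ - c₁)) * q₀ + (l₁ - c₁) - (1 - χ) * (c₂ - c₁) ∧
    (IsPriceList c₁ c₂ l₁ l₂ l₁ (l₁ + q₀ * (l₂ - l₁) / (1 - χ + χ * q₀)) ∧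
      l₁ - c₁ ≤ (l₁ + q₀ * (l₂ - l₁) / (1 - χ + χ * q₀)) - c₂) ∧
    ∀ p₁ p₂ : ℝ, IsPriceList c₁ c₂ l₁ l₂ p₁ p₂ → p₁ - c₁ ≤ p₂ - c₂ →
      vStar c₁ c₂ l₁ l₂ χ q₀ p₁ p₂
        = ((l₂ - l₁) - χ * (c₂ - c₁)) * q₀ + (l₁ - c₁) - (1 - χ) * (c₂ - c₁) →
      p₁ = l₁ ∧ p₂ = l₁ + q₀ * (l₂ - l₁) / (1 - χ + χ * q₀) := by
  have hl : l₁ < l₂ := by linarith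
  have hχs : chiStarF c₁ c₂ l₁ l₂ q₀ < χ := (le_max_left _ _).trans_lt hχ'
  have hlt := fun p₁ p₂ => vStar_lt_or_eq (p₁ := p₁) (p₂ := p₂) hc₁ hc h₁ hl hq₀ hχ hχs
  obtain ⟨hq0, hq1⟩ := hq₀
  obtain ⟨hχ0, hχ1⟩ := hχ
  have hD : 0 < l₂ - l₁ := sub_pos.2 hl
  have hl₁ : 0 < l₁ := hc₁.trans_lt h₁
  have hk : 0 < 1 - χ + χ * q₀ := by nlinarith
  have hk1 : 1 - χ + χ * q₀ < 1 := by nlinarith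
  have hkq : q₀ < 1 - χ + χ * q₀ := by nlinarith
  rw [chiStarF_lt_iff hc hq1, ← lt_div_iff₀ hk] at hχs
  have hle : q₀ * (l₂ - l₁) / (1 - χ + χ * q₀) ≤ l₂ - l₁ := by
    rw [div_le_iff₀ hk]
    nlinarith
  have hq : qBar l₁ l₂ l₁ (l₁ + q₀ * (l₂ - l₁) / (1 - χ + χ * q₀)) = q₀ / (1 - χ + χ * q₀) := by
    rw [qBar_self_left hl₁.ne' (by linarith)]
    field_simp
    ring
  have hval : vStar c₁ c₂ l₁ l₂ χ q₀ l₁ (l₁ + q₀ * (l₂ - l₁) / (1 - χ + χ * q₀))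
      = ((l₂ - l₁) - χ * (c₂ - c₁)) * q₀ + (l₁ - c₁) - (1 - χ) * (c₂ - c₁) := by
    have hge : q₀ ≤ q₀ / (1 - χ + χ * q₀) := by
      rw [le_div_iff₀ hk]
      nlinarith
    have hlt1 : q₀ / (1 - χ + χ * q₀) < 1 := (div_lt_one hk).2 hkq
    rw [vStar, if_neg (by rw [hq]; exact hge.not_gt), if_pos, lamP, hq]
    · have e : (l₁ + q₀ * (l₂ - l₁) / (1 - χ + χ * q₀) - c₂ - (l₁ - c₁)) /
          (q₀ / (1 - χ + χ * q₀)) * q₀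
          = q₀ * (l₂ - l₁) - (c₂ - c₁) * (1 - χ + χ * q₀) := by
        field_simp
        ring
      rw [e]
      ring
    · rw [qLo_le_iff (by rw [hq]; nlinarith), hq, div_mul_cancel₀ _ hk.ne']
  have hadm : IsPriceList c₁ c₂ l₁ l₂ l₁ (l₁ + q₀ * (l₂ - l₁) / (1 - χ + χ * q₀)) :=
    ⟨h₁.le, le_rfl, by linarith, by linarith, by linarith⟩
  refine ⟨⟨⟨_, _, hadm, by linarith, hval.symm⟩, ?_⟩, hval, ⟨hadm, by linarith⟩, ?_⟩
  · rintro e ⟨p₁, p₂, hp, -, rfl⟩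
    rcases hlt p₁ p₂ hp with h | ⟨rfl, rfl⟩
    · exact h.le
    · exact hval.le
  · intro p₁ p₂ hp _ he
    exact (hlt p₁ p₂ hp).resolve_left he.not_lt
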